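/- The following two statements are equivalent: (1) there exists a word hyperbolic group that is not residually finite; (2) there exists a word hyperbolic group G having an almost malnormal quasiconvex subgroup H which is not separable in G. -/

import Mathlib

open scoped Pointwise

/-- `S` is a finite symmetrized generating set of the group `G`. -/
def IsSymmGenSet {G : Type*} [Group G] (S : Set G) : Prop :=
  S.Finite ∧ S⁻¹ = S ∧ Subgroup.closure S = ⊤

/-- The word length of `g` with respect to the generating set `S`: the length of a
shortest word over `S` representing `g`. -/
noncomputable def wordLength {G : Type*} [Group G] (S : Set G) (g : G) : ℕ :=
  sInf {n : ℕ | ∃ f : Fin n → G, (∀ i, f i ∈ S) ∧ (List.ofFn f).prod = g}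

/-- The left-invariant word metric `d(x,y) = |x⁻¹y|_G` on `G`. -/
noncomputable def wordDist {G : Type*} [Group G] (S : Set G) (x y : G) : ℕ :=
  wordLength S (x⁻¹ * y)

/-- The Gromov product `(x|y)_w = (d(x,w)+d(y,w)-d(x,y))/2`. -/
noncomputable def gromovProd {G : Type*} [Group G] (S : Set G) (x y w : G) : ℝ :=
  ((wordDist S w x : ℝ) + (wordDist S w y : ℝ) - (wordDist S x y : ℝ)) / 2

/-- A discrete geodesic from `u` to `v` in the Cayley graph `Γ(G,S)`: a sequence of
vertices `p 0 = u, ..., p (d(u,v)) = v` with `d(p i, p j) = j - i`. -/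
def IsGeodesic {G : Type*} [Group G] (S : Set G) (u v : G) (p : ℕ → G) : Prop :=
  p 0 = u ∧ p (wordDist S u v) = v ∧
    ∀ i j : ℕ, i ≤ j → j ≤ wordDist S u v → wordDist S (p i) (p j) = j - i

/-- A subset `Q ⊆ G` is `ε`-quasiconvex if every geodesic between two elements of `Q`
lies in the closed `ε`-neighborhood of `Q`. -/
def IsQuasiconvex {G : Type*} [Group G] (S : Set G) (ε : ℝ) (Q : Set G) : Prop :=
  ∀ u ∈ Q, ∀ v ∈ Q, ∀ p : ℕ → G, IsGeodesic S u v p →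
    ∀ i ≤ wordDist S u v, ∃ q ∈ Q, (wordDist S (p i) q : ℝ) ≤ ε

/-- All geodesic triangles in `Γ(G,S)` are `δ`-thin: two points on the sides of a
geodesic triangle, equidistant from a common vertex (within the Gromov product),
are at distance at most `δ` from each other. -/
def ThinTriangles {G : Type*} [Group G] (S : Set G) (δ : ℝ) : Prop :=
  ∀ a b c : G, ∀ p q : ℕ → G, IsGeodesic S a b p → IsGeodesic S a c q →
    ∀ i : ℕ, (i : ℝ) ≤ gromovProd S b c a → (wordDist S (p i) (q i) : ℝ) ≤ δ

/-- The profinite topology on `G`: cosets of finite index normal subgroups form a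
basis of open sets (equivalently, a basis of neighborhoods of the identity). -/
def profiniteTopology (G : Type*) [Group G] : TopologicalSpace G :=
  TopologicalSpace.generateFrom
    {U : Set G | ∃ (g : G) (N : Subgroup G), N.Normal ∧ N.FiniteIndex ∧ U = g • (N : Set G)}

/-- A subset of `G` is separable if it is closed in the profinite topology on `G`. -/
def SeparableSubset (G : Type*) [Group G] (P : Set G) : Prop :=
  @IsClosed G (profiniteTopology G) P

/-- A word hyperbolic group `G` (with finite symmetrized generating set `S`) is GFERF
if every quasiconvex subgroup of `G` is separable. -/
def GFERF {G : Type*} [Group G] (S : Set G) : Prop :=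
  ∀ H : Subgroup G, (∃ ε : ℝ, 0 ≤ ε ∧ IsQuasiconvex S ε (H : Set G)) →
    SeparableSubset G (H : Set G)

/-- A `(λ,c)`-quasigeodesic path of length `n` in the Cayley graph `Γ(G,S)`:
consecutive vertices are adjacent and every subpath `p|_{[i,j]}` satisfies
`λ(j-i) - c ≤ d(p i, p j)`. -/
def IsQuasigeodesicOn {G : Type*} [Group G] (S : Set G) (lam c : ℝ) (p : ℕ → G) (n : ℕ) : Prop :=
  (∀ i < n, wordDist S (p i) (p (i + 1)) = 1) ∧
    ∀ i j : ℕ, i ≤ j → j ≤ n → lam * ((j : ℝ) - (i : ℝ)) - c ≤ (wordDist S (p i) (p j) : ℝ)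

/-- `G` is residually finite: the intersection of all finite index normal subgroups
of `G` is trivial. -/
def ResiduallyFinite (G : Type*) [Group G] : Prop :=
  (⨅ N ∈ {N : Subgroup G | N.Normal ∧ N.FiniteIndex}, N) = (⊥ : Subgroup G)

/-- A subgroup `H ≤ G` is almost malnormal if for every `x ∈ G ∖ H` the intersection
`H ∩ xHx⁻¹` is finite. -/
def AlmostMalnormal {G : Type*} [Group G] (H : Subgroup G) : Prop :=
  ∀ x : G, x ∉ H → ((H : Set G) ∩ ((fun h => x * h * x⁻¹) '' (H : Set G))).Finite

namespace WordMetric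

variable {G : Type*} [Group G] {S : Set G}

lemma wordLength_le_length {l : List G} (hl : ∀ x ∈ l, x ∈ S) :
    wordLength S l.prod ≤ l.length := by
  apply Nat.sInf_le
  exact ⟨l.get, fun i => hl _ (l.get_mem i), by rw [List.ofFn_get]⟩

lemma exists_list (hS : IsSymmGenSet S) (g : G) :
    ∃ l : List G, (∀ x ∈ l, x ∈ S) ∧ l.prod = g ∧ l.length = wordLength S g := by
  have hne : {n : ℕ | ∃ f : Fin n → G, (∀ i, f i ∈ S) ∧ (List.ofFn f).prod = g}.Nonempty := by
    have hg : g ∈ (Subgroup.closure S).toSubmonoid := by rw [hS.2.2]; trivial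
    rw [Subgroup.closure_toSubmonoid] at hg
    obtain ⟨l, hl, hp⟩ := Submonoid.exists_list_of_mem_closure hg
    refine ⟨l.length, l.get, fun i => ?_, by rw [List.ofFn_get, hp]⟩
    rcases hl _ (l.get_mem i) with h | h
    · exact h
    · rw [← hS.2.1]; exact h
  obtain ⟨f, hf, hp⟩ := Nat.sInf_mem hne
  refine ⟨List.ofFn f, ?_, hp, by rw [List.length_ofFn]; rfl⟩
  intro x hx
  obtain ⟨i, rfl⟩ := (List.mem_ofFn' f x).1 hx
  exact hf i

lemma wordLength_one : wordLength S (1 : G) = 0 := by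
  simpa using wordLength_le_length (S := S) (l := []) (by simp)

lemma wordLength_mul_le (hS : IsSymmGenSet S) (g h : G) :
    wordLength S (g * h) ≤ wordLength S g + wordLength S h := by
  obtain ⟨l, hl, rfl, hn⟩ := exists_list hS g
  obtain ⟨m, hm, rfl, hk⟩ := exists_list hS h
  rw [← hn, ← hk, ← List.prod_append, ← List.length_append]
  apply wordLength_le_length
  intro x hx
  rcases List.mem_append.1 hx with h | h
  exacts [hl x h, hm x h]

lemma wordLength_inv_le (hS : IsSymmGenSet S) (g : G) :
    wordLength S g⁻¹ ≤ wordLength S g := by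
  obtain ⟨l, hl, rfl, hn⟩ := exists_list hS g
  rw [List.prod_inv_reverse, ← hn]
  refine (wordLength_le_length ?_).trans (by simp)
  intro x hx
  simp only [List.mem_reverse, List.mem_map] at hx
  obtain ⟨y, hy, rfl⟩ := hx
  rw [← hS.2.1]
  simpa using hl y hy

lemma wordLength_inv (hS : IsSymmGenSet S) (g : G) :
    wordLength S g⁻¹ = wordLength S g :=
  le_antisymm (wordLength_inv_le hS g) (by simpa using wordLength_inv_le hS g⁻¹)

lemma wordLength_le_one {s : G} (hs : s ∈ S) : wordLength S s ≤ 1 := by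
  simpa using wordLength_le_length (S := S) (l := [s]) (by simpa using hs)

lemma eq_one_of_wordLength_eq_zero (hS : IsSymmGenSet S) {g : G} (h : wordLength S g = 0) :
    g = 1 := by
  obtain ⟨l, -, rfl, hn⟩ := exists_list hS g
  rw [h, List.length_eq_zero_iff] at hn
  simp [hn]

lemma exists_mul_of_wordLength_eq_succ (hS : IsSymmGenSet S) {g : G} {n : ℕ}
    (h : wordLength S g = n + 1) : ∃ s ∈ S, ∃ g', g = s * g' ∧ wordLength S g' = n := by
  obtain ⟨l, hl, rfl, hn⟩ := exists_list hS g
  rw [h] at hn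
  match l, hl, hn, h with
  | s :: l, hl, hn, h =>
    refine ⟨s, hl s (by simp), l.prod, by simp, le_antisymm ?_ ?_⟩
    · exact (wordLength_le_length fun x hx => hl x (by simp [hx])).trans (by simpa using hn.le)
    · have h1 := wordLength_mul_le hS s l.prod
      have h2 := wordLength_le_one (hl s (by simp))
      rw [List.prod_cons] at h
      omega

lemma finite_ball (hS : IsSymmGenSet S) (n : ℕ) : {g : G | wordLength S g ≤ n}.Finite := by
  induction n with
  | zero =>
    refine (Set.finite_singleton (1 : G)).subset fun g hg => ?_
    exact eq_one_of_wordLength_eq_zero hS (Nat.le_zero.1 hg)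
  | succ n ih =>
    refine (ih.union (hS.1.mul ih)).subset fun g hg => ?_
    rcases Nat.lt_or_ge n (wordLength S g) with h | h
    · obtain ⟨s, hs, g', rfl, hg'⟩ := exists_mul_of_wordLength_eq_succ hS
        (le_antisymm hg h : wordLength S g = n + 1)
      exact Or.inr ⟨s, hs, g', hg'.le, rfl⟩
    · exact Or.inl h

/-- The word metric with real values. -/
noncomputable def rdist (S : Set G) (x y : G) : ℝ := wordDist S x y

lemma rdist_nonneg (x y : G) : 0 ≤ rdist S x y := Nat.cast_nonneg _

lemma rdist_self (x : G) : rdist S x x = 0 := by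
  simp [rdist, wordDist, wordLength_one]

lemma rdist_comm (hS : IsSymmGenSet S) (x y : G) : rdist S x y = rdist S y x := by
  unfold rdist wordDist
  rw [← wordLength_inv hS (x⁻¹ * y)]
  simp

lemma rdist_triangle (hS : IsSymmGenSet S) (x y z : G) :
    rdist S x z ≤ rdist S x y + rdist S y z := by
  unfold rdist wordDist
  have := wordLength_mul_le hS (x⁻¹ * y) (y⁻¹ * z)
  rw [show x⁻¹ * y * (y⁻¹ * z) = x⁻¹ * z by group] at this
  exact_mod_cast this

lemma rdist_mul_left (g x y : G) : rdist S (g * x) (g * y) = rdist S x y := by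
  simp [rdist, wordDist, mul_assoc]

lemma exists_geodesic (hS : IsSymmGenSet S) (x y : G) : ∃ p : ℕ → G, IsGeodesic S x y p := by
  obtain ⟨l, hl, hp, hn⟩ := exists_list hS (x⁻¹ * y)
  have hlen : l.length = wordDist S x y := hn
  have hstep : ∀ i j, i ≤ j → j ≤ l.length →
      wordLength S ((l.take i).prod⁻¹ * (l.take j).prod) ≤ j - i := by
    intro i j hij hj
    have h1 : l.take j = l.take i ++ (l.take j).drop i := by
      conv_lhs => rw [← List.take_append_drop i (l.take j)]
      rw [List.take_take, min_eq_left hij]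
    rw [h1, List.prod_append, inv_mul_cancel_left]
    refine (wordLength_le_length fun z hz => hl z
      (List.mem_of_mem_take (List.mem_of_mem_drop hz))).trans ?_
    simp only [List.length_drop, List.length_take]
    omega
  refine ⟨fun i => x * (l.take i).prod, by simp, ?_, fun i j hij hj => ?_⟩
  · simp only
    rw [← hlen, List.take_length, hp]
    group
  · rw [← hlen] at hj
    have h1 := hstep 0 i (Nat.zero_le _) (hij.trans hj)
    have h2 := hstep i j hij hj
    have h3 := hstep j l.length hj le_rfl
    have h4 := wordLength_mul_le hS ((l.take i).prod) ((l.take i).prod⁻¹ * (l.take j).prod)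
    have h5 := wordLength_mul_le hS ((l.take j).prod) ((l.take j).prod⁻¹ * (l.take l.length).prod)
    rw [mul_inv_cancel_left] at h4 h5
    rw [List.take_length, hp] at h5 h3
    simp only [List.take_zero, List.prod_nil, inv_one, one_mul] at h1
    have h6 : wordDist S (x * (l.take i).prod) (x * (l.take j).prod) =
        wordLength S ((l.take i).prod⁻¹ * (l.take j).prod) := by
      simp [wordDist, mul_assoc]
    rw [h6]
    omega

lemma exists_first_crossing (hS : IsSymmGenSet S) (P : G → Prop) {x y : G} (hx : P x)
    (hy : ¬ P y) : ∃ z, ∃ s ∈ S, P z ∧ ¬ P (z * s) ∧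
      rdist S x z + 1 + rdist S (z * s) y ≤ rdist S x y := by
  obtain ⟨n, hn⟩ : ∃ n, wordDist S x y = n := ⟨_, rfl⟩
  induction n generalizing x with
  | zero =>
    have := eq_one_of_wordLength_eq_zero hS hn
    rw [inv_mul_eq_one] at this
    exact absurd (this ▸ hx) hy
  | succ n ih =>
    obtain ⟨s, hs, g, hg, hgn⟩ := exists_mul_of_wordLength_eq_succ hS hn
    have h1 : wordDist S (x * s) y = n := by
      rw [← hgn, wordDist, mul_inv_rev, mul_assoc, hg, inv_mul_cancel_left]
    have h2 : rdist S x y = n + 1 := by simp [rdist, hn]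
    have h3 : rdist S (x * s) y = n := by simp [rdist, h1]
    by_cases hP : P (x * s)
    · obtain ⟨z, s', hs', hz, hz', hd⟩ := ih hP h1
      refine ⟨z, s', hs', hz, hz', ?_⟩
      have h4 := rdist_triangle hS x (x * s) z
      have h5 : rdist S x (x * s) ≤ 1 := by
        have := wordLength_le_one hs
        simp only [rdist, wordDist, inv_mul_cancel_left]
        exact_mod_cast this
      linarith
    · exact ⟨x, s, hs, hx, hP, by rw [rdist_self]; linarith⟩

/-- The four point inequality characterising hyperbolicity of the word metric. -/
def FourPoint (S : Set G) (δ : ℝ) : Prop :=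
  ∀ x y z w : G, rdist S x z + rdist S y w ≤
    max (rdist S x y + rdist S z w) (rdist S y z + rdist S x w) + 2 * δ

lemma IsGeodesic.rdist_left {x y : G} {p : ℕ → G} (hp : IsGeodesic S x y p) {i : ℕ}
    (hi : i ≤ wordDist S x y) : rdist S x (p i) = i := by
  have := hp.2.2 0 i (Nat.zero_le _) hi
  rw [hp.1] at this
  simp [rdist, this]

lemma IsGeodesic.rdist_right {x y : G} {p : ℕ → G} (hp : IsGeodesic S x y p) {i : ℕ}
    (hi : i ≤ wordDist S x y) : rdist S (p i) y = rdist S x y - i := by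
  have := hp.2.2 i _ hi le_rfl
  rw [hp.2.1] at this
  simp [rdist, this, Nat.cast_sub hi]

lemma IsGeodesic.rdist_between {x y : G} {p : ℕ → G} (hp : IsGeodesic S x y p) {i j : ℕ}
    (hij : i ≤ j) (hj : j ≤ wordDist S x y) : rdist S (p i) (p j) = j - i := by
  simp [rdist, hp.2.2 i j hij hj, Nat.cast_sub hij]

lemma fourPoint_of_thinTriangles (hS : IsSymmGenSet S) {δ : ℝ} (h : ThinTriangles S δ) :
    FourPoint S (δ + 1) := by
  intro x y z w
  by_contra! hcon
  obtain ⟨p, hp⟩ := exists_geodesic hS w x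
  obtain ⟨q, hq⟩ := exists_geodesic hS w z
  obtain ⟨r, hr⟩ := exists_geodesic hS w y
  set m := min (gromovProd S x y w) (gromovProd S y z w) with hm
  have gp : ∀ a b, gromovProd S a b w = (rdist S w a + rdist S w b - rdist S a b) / 2 :=
    fun a b => rfl
  have c1 := rdist_comm hS x w
  have c2 := rdist_comm hS z w
  have c3 := rdist_comm hS y w
  have c4 := rdist_comm hS x y
  have t1 := rdist_triangle hS x w y
  have t2 := rdist_triangle hS y w z
  have t3 := rdist_triangle hS w x y
  have t4 := rdist_triangle hS w z y
  have t5 := rdist_triangle hS w y x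
  have c5 := rdist_comm hS z y
  have hm0 : 0 ≤ m := le_min (by rw [gp]; linarith) (by rw [gp]; linarith)
  have hfl := Nat.floor_le hm0
  have hlt := Nat.lt_floor_add_one m
  set i := ⌊m⌋₊
  have hi1 : (i : ℝ) ≤ gromovProd S x y w := hfl.trans (min_le_left _ _)
  have hi2 : (i : ℝ) ≤ gromovProd S y z w := hfl.trans (min_le_right _ _)
  have e1 := h w x y p r hp hr i hi1
  have e2 := h w y z r q hr hq i hi2
  change rdist S (p i) (r i) ≤ δ at e1
  change rdist S (r i) (q i) ≤ δ at e2
  rw [gp] at hi1 hi2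
  have hix : i ≤ wordDist S w x := by
    have : (i : ℝ) ≤ rdist S w x := by linarith
    exact Nat.cast_le.1 this
  have hiz : i ≤ wordDist S w z := by
    have : (i : ℝ) ≤ rdist S w z := by linarith
    exact Nat.cast_le.1 this
  have f1 := IsGeodesic.rdist_right hp hix
  have f2 := IsGeodesic.rdist_right hq hiz
  have u1 := rdist_triangle hS x (p i) z
  have u2 := rdist_triangle hS (p i) (q i) z
  have u3 := rdist_triangle hS (p i) (r i) (q i)
  have u4 := rdist_comm hS x (p i)
  have g1 := le_max_left (rdist S x y + rdist S z w) (rdist S y z + rdist S x w)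
  have g2 := le_max_right (rdist S x y + rdist S z w) (rdist S y z + rdist S x w)
  rcases min_choice (gromovProd S x y w) (gromovProd S y z w) with hc | hc
  · rw [hc, gp] at hm
    linarith
  · rw [hc, gp] at hm
    linarith

/-- If a point on a geodesic always has a small Gromov product with one of the endpoints and any
third point, then geodesic triangles are thin. -/
lemma thinTriangles_of_gromovProd_le (hS : IsSymmGenSet S) {C : ℝ}
    (h : ∀ x y z m : G, rdist S x m + rdist S m y = rdist S x y →
      rdist S x m + rdist S m z - rdist S x z ≤ C ∨ rdist S y m + rdist S m z - rdist S y z ≤ C) :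
    ThinTriangles S (2 * C) := by
  intro a b c p q hp hq i hi
  have gp : gromovProd S b c a = (rdist S a b + rdist S a c - rdist S b c) / 2 := rfl
  rw [gp] at hi
  change rdist S (p i) (q i) ≤ 2 * C
  have t1 := rdist_triangle hS a b c
  have t2 := rdist_triangle hS a c b
  have c1 := rdist_comm hS b c
  have hib : i ≤ wordDist S a b := by
    have : (i : ℝ) ≤ rdist S a b := by linarith
    exact Nat.cast_le.1 this
  have hic : i ≤ wordDist S a c := by
    have : (i : ℝ) ≤ rdist S a c := by linarith
    exact Nat.cast_le.1 this
  have p1 := IsGeodesic.rdist_left hp hib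
  have p2 := IsGeodesic.rdist_right hp hib
  have q1 := IsGeodesic.rdist_left hq hic
  have q2 := IsGeodesic.rdist_right hq hic
  have c2 := rdist_comm hS b (p i)
  have c3 := rdist_comm hS c (q i)
  have c4 := rdist_comm hS c (p i)
  have c5 := rdist_comm hS (q i) (p i)
  have n1 := rdist_nonneg (S := S) (p i) (q i)
  have key : rdist S (p i) c ≤ C + rdist S a c - i := by
    rcases h a b c (p i) (by linarith) with h' | h' <;> linarith
  rcases h a c (p i) (q i) (by linarith) with h' | h' <;> linarith

variable {H : Subgroup G} {δ ε : ℝ}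

lemma exists_geodesic_point_near_coset (hS : IsSymmGenSet S) (hQ : IsQuasiconvex S ε (H : Set G))
    {c : G ⧸ H} {u v : G} (hu : (u : G ⧸ H) = c) (hv : (v : G ⧸ H) = c) {i : ℕ}
    (hi : (i : ℝ) ≤ rdist S u v) :
    ∃ n q : G, rdist S u n = i ∧ rdist S n v = rdist S u v - i ∧
      (q : G ⧸ H) = c ∧ rdist S n q ≤ ε := by
  subst hu
  have hH : u⁻¹ * v ∈ H := QuotientGroup.eq.1 hv.symm
  obtain ⟨p, hp⟩ := exists_geodesic hS 1 (u⁻¹ * v)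
  have hd : rdist S 1 (u⁻¹ * v) = rdist S u v := by
    rw [← rdist_mul_left u, mul_one, mul_inv_cancel_left]
  have hi' : i ≤ wordDist S 1 (u⁻¹ * v) := by
    rw [← hd] at hi
    exact Nat.cast_le.1 hi
  obtain ⟨q, hq, hqd⟩ := hQ 1 H.one_mem _ hH p hp i hi'
  refine ⟨u * p i, u * q, ?_, ?_, ?_, ?_⟩
  · rw [← IsGeodesic.rdist_left hp hi', ← rdist_mul_left u 1, mul_one]
  · rw [← hd, ← IsGeodesic.rdist_right hp hi', ← rdist_mul_left u (p i), mul_inv_cancel_left]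
  · exact QuotientGroup.eq.2 (by simpa using hq)
  · rw [rdist_mul_left]
    exact hqd

lemma exists_coset_point_near (hS : IsSymmGenSet S) (h4 : FourPoint S δ) (hδ : 0 ≤ δ)
    (hQ : IsQuasiconvex S ε (H : Set G)) (hε : 0 ≤ ε) {C : ℝ} {c : G ⧸ H} {u v p : G}
    (hu : (u : G ⧸ H) = c) (hv : (v : G ⧸ H) = c)
    (hp : rdist S u p + rdist S p v ≤ rdist S u v + C) :
    ∃ k : G, (k : G ⧸ H) = c ∧ rdist S p k ≤ C + 2 * δ + ε := by
  have hC : 0 ≤ C := by linarith [rdist_triangle hS u p v]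
  rcases le_total (rdist S u p) (rdist S u v) with h | h
  · obtain ⟨n, q, h1, h2, hq, hnq⟩ :=
      exists_geodesic_point_near_coset hS hQ hu hv (i := wordDist S u p) h
    have h1' : rdist S u n = rdist S u p := h1
    have h2' : rdist S n v = rdist S u v - rdist S u p := h2
    refine ⟨q, hq, ?_⟩
    have t := rdist_triangle hS p n q
    have c1 := rdist_comm hS p u
    have h := h4 p u n v
    rcases max_choice (rdist S p u + rdist S n v) (rdist S u n + rdist S p v) with h' | h' <;>
      rw [h'] at h <;> linarith
  · exact ⟨v, hv, by linarith⟩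

lemma exists_coset_projection (hS : IsSymmGenSet S) (h4 : FourPoint S δ) (hδ : 0 ≤ δ)
    (hQ : IsQuasiconvex S ε (H : Set G)) (hε : 0 ≤ ε) (c : G ⧸ H) (p : G) :
    ∃ q : G, (q : G ⧸ H) = c ∧ ∀ u : G, (u : G ⧸ H) = c →
      rdist S p q + rdist S q u ≤ rdist S p u + 2 * (ε + 2 * δ + 1) := by
  classical
  have hex : ∃ n, ∃ q : G, (q : G ⧸ H) = c ∧ wordDist S p q = n := by
    obtain ⟨q, rfl⟩ := QuotientGroup.mk_surjective c
    exact ⟨_, q, rfl, rfl⟩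
  obtain ⟨q, hq, hqn⟩ := Nat.find_spec hex
  have hmin : ∀ u : G, (u : G ⧸ H) = c → rdist S p q ≤ rdist S p u := by
    intro u hu
    have := Nat.find_min' hex ⟨u, hu, rfl⟩
    rw [← hqn] at this
    exact Nat.cast_le.2 this
  refine ⟨q, hq, fun u hu => ?_⟩
  by_contra! hcon
  have hpos : 0 ≤ ε + 2 * δ := by linarith
  have hK := Nat.lt_floor_add_one (ε + 2 * δ)
  have hK' := Nat.floor_le hpos
  set i := ⌊ε + 2 * δ⌋₊ + 1 with hi
  have hic : (i : ℝ) = ⌊ε + 2 * δ⌋₊ + 1 := by rw [hi]; push_cast; ring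
  have t1 := rdist_triangle hS p u q
  have c1 := rdist_comm hS q u
  obtain ⟨n, k, h1, h2, hk, hnk⟩ :=
    exists_geodesic_point_near_coset hS hQ hq hu (i := i) (by linarith)
  have m1 := hmin k hk
  have t2 := rdist_triangle hS p n k
  have h := h4 p q n u
  rcases max_choice (rdist S p q + rdist S n u) (rdist S q n + rdist S p u) with h' | h' <;>
    rw [h'] at h <;> linarith

lemma bounded_coarse_intersection (hS : IsSymmGenSet S) (h4 : FourPoint S δ) (hδ : 0 ≤ δ)
    (hQ : IsQuasiconvex S ε (H : Set G)) (hε : 0 ≤ ε) (hM : AlmostMalnormal H) (R : ℝ) :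
    ∃ B : ℝ, ∀ c c' : G ⧸ H, c ≠ c' → ∀ p q a a' b b' : G,
      (a : G ⧸ H) = c → (b : G ⧸ H) = c → (a' : G ⧸ H) = c' → (b' : G ⧸ H) = c' →
      rdist S p a ≤ R → rdist S q b ≤ R → rdist S p a' ≤ R → rdist S q b' ≤ R →
      rdist S p q ≤ B := by
  classical
  set R' : ℝ := 4 * R + 2 * δ + ε with hR'
  set ball : Set G := {g | wordLength S g ≤ ⌊2 * R'⌋₊}
  have hball : ball.Finite := finite_ball hS _
  set F : Set G := ⋃ r ∈ ball \ (H : Set G), ((H : Set G) ∩ ((fun h => r * h * r⁻¹) '' (H : Set G)))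
  have hF : F.Finite := (hball.subset Set.sdiff_subset).biUnion fun r hr => hM r hr.2
  obtain ⟨M, hM⟩ : ∃ M : ℕ, ∀ g ∈ F, wordLength S g ≤ M := by
    obtain ⟨M, hM⟩ := (hF.image (wordLength S)).bddAbove
    exact ⟨M, fun g hg => hM ⟨g, hg, rfl⟩⟩
  set N := hball.toFinset.card
  set L : ℕ := M + ⌊2 * R'⌋₊ + 2 with hL
  refine ⟨(N * L : ℕ), fun c c' hcc p q a a' b b' ha hb ha' hb' hpa hqb hpa' hqb' => ?_⟩
  by_contra! hlong
  obtain ⟨γ, hγ⟩ := exists_geodesic hS p q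
  have hlong' : N * L ≤ wordDist S p q := (Nat.cast_lt.1 hlong).le
  have hnear : ∀ (e : G ⧸ H) (x y : G), (x : G ⧸ H) = e → (y : G ⧸ H) = e → rdist S p x ≤ R →
      rdist S q y ≤ R → ∀ i ≤ wordDist S p q, ∃ k : G, (k : G ⧸ H) = e ∧ rdist S (γ i) k ≤ R' := by
    intro e x y hx hy hpx hqy i hi
    have g1 := IsGeodesic.rdist_left hγ hi
    have g2 := IsGeodesic.rdist_right hγ hi
    have t1 := rdist_triangle hS x p (γ i)
    have t2 := rdist_triangle hS (γ i) q y
    have t3 := rdist_triangle hS p x q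
    have t4 := rdist_triangle hS x y q
    have c1 := rdist_comm hS x p
    have c2 := rdist_comm hS q y
    exact exists_coset_point_near hS h4 hδ hQ hε hx hy (C := 4 * R) (p := γ i) (by linarith)
  have hidx : ∀ j : Fin (N + 1), j.1 * L ≤ wordDist S p q := fun j =>
    (Nat.mul_le_mul_right L (Nat.lt_succ_iff.1 j.2)).trans hlong'
  choose k hk hkd using fun j : Fin (N + 1) => hnear c a b ha hb hpa hqb _ (hidx j)
  choose k' hk' hkd' using fun j : Fin (N + 1) => hnear c' a' b' ha' hb' hpa' hqb' _ (hidx j)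
  have hmem : ∀ j ∈ (Finset.univ : Finset (Fin (N + 1))), (k j)⁻¹ * k' j ∈ hball.toFinset := by
    intro j _
    rw [Set.Finite.mem_toFinset]
    apply Nat.le_floor
    have t := rdist_triangle hS (k j) (γ (j.1 * L)) (k' j)
    have c1 := rdist_comm hS (k j) (γ (j.1 * L))
    have := hkd j
    have := hkd' j
    change rdist S (k j) (k' j) ≤ 2 * R'
    linarith
  obtain ⟨i, -, j, -, hij, hr⟩ := Finset.exists_ne_map_eq_of_card_lt_of_maps_to
    (by simp [N]) hmem
  wlog hlt : i < j generalizing i j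
  · exact this j i hij.symm hr.symm (lt_of_le_of_ne (not_lt.1 hlt) hij.symm)
  have hrball := (Set.Finite.mem_toFinset _).1 (hmem i (Finset.mem_univ _))
  have hrH : (k i)⁻¹ * k' i ∉ H := fun hcon => hcc (by
    rw [← hk i, ← hk' i]; exact QuotientGroup.eq.2 hcon)
  have hF' : (k i)⁻¹ * k j ∈ F := by
    refine Set.mem_biUnion ⟨hrball, hrH⟩ ⟨QuotientGroup.eq.1 ((hk i).trans (hk j).symm),
      (k' i)⁻¹ * k' j, QuotientGroup.eq.1 ((hk' i).trans (hk' j).symm), ?_⟩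
    simp only [mul_inv_rev, inv_inv]
    calc (k i)⁻¹ * k' i * ((k' i)⁻¹ * k' j) * ((k' i)⁻¹ * k i)
        = (k i)⁻¹ * k j * ((k j)⁻¹ * k' j) * ((k i)⁻¹ * k' i)⁻¹ := by group
      _ = (k i)⁻¹ * k j := by rw [hr]; group
  have hshort : rdist S (k i) (k j) ≤ M := Nat.cast_le.2 (hM _ hF')
  have g1 := IsGeodesic.rdist_between hγ (Nat.mul_le_mul_right L hlt.le) (hidx j)
  have t1 := rdist_triangle hS (γ (i.1 * L)) (k i) (γ (j.1 * L))
  have t2 := rdist_triangle hS (k i) (k j) (γ (j.1 * L))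
  have c1 := rdist_comm hS (k j) (γ (j.1 * L))
  have d1 := hkd i
  have d2 := hkd j
  have hfl := Nat.lt_floor_add_one (2 * R')
  have hstep : (L : ℝ) ≤ (j.1 * L : ℕ) - (i.1 * L : ℕ) := by
    have : i.1 * L + L ≤ j.1 * L := by
      have := Nat.mul_le_mul_right L (Nat.succ_le_of_lt (Fin.lt_def.1 hlt))
      rwa [Nat.succ_mul] at this
    have : ((i.1 * L : ℕ) : ℝ) + L ≤ (j.1 * L : ℕ) := by exact_mod_cast this
    linarith
  have hLr : (L : ℝ) = M + ⌊2 * R'⌋₊ + 2 := by rw [hL]; push_cast; ring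
  linarith

lemma exists_common_projection (hS : IsSymmGenSet S) (h4 : FourPoint S δ) (hδ : 0 ≤ δ)
    (hQ : IsQuasiconvex S ε (H : Set G)) (hε : 0 ≤ ε) (hM : AlmostMalnormal H) :
    ∃ B : ℝ, 0 ≤ B ∧ ∀ c c' : G ⧸ H, c ≠ c' → ∃ q : G, (q : G ⧸ H) = c' ∧
      ∀ w u : G, (w : G ⧸ H) = c → (u : G ⧸ H) = c' →
        rdist S w q + rdist S q u ≤ rdist S w u + B := by
  set C₁ : ℝ := 2 * (ε + 2 * δ + 1) with hC₁
  set R : ℝ := 2 * C₁ + 4 * δ + ε with hR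
  obtain ⟨B₀, hB₀⟩ := bounded_coarse_intersection hS h4 hδ hQ hε hM R
  set B₁ := max B₀ (C₁ + δ)
  have hB₁ : 0 ≤ B₁ := le_max_of_le_right (by linarith)
  refine ⟨2 * B₁ + C₁, by linarith, fun c c' hcc => ?_⟩
  obtain ⟨w₀, hw₀⟩ := QuotientGroup.mk_surjective c
  obtain ⟨q, hq, hqp⟩ := exists_coset_projection hS h4 hδ hQ hε c' w₀
  refine ⟨q, hq, fun w u hw hu => ?_⟩
  obtain ⟨r, hr, hrp⟩ := exists_coset_projection hS h4 hδ hQ hε c' w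
  have hqr : rdist S q r ≤ B₁ := by
    rcases le_or_gt (rdist S q r) (C₁ + δ) with h | h
    · exact h.trans (le_max_right _ _)
    · refine le_trans ?_ (le_max_left _ _)
      have p1 := hqp r hr
      have p2 := hrp q hq
      have c1 := rdist_comm hS r q
      have c2 := rdist_comm hS w q
      have c3 := rdist_comm hS w r
      have f := h4 w₀ q r w
      have hw₀w : rdist S w₀ q + rdist S q r + rdist S r w ≤
          rdist S w₀ w + (2 * C₁ + 2 * δ) := by
        rcases max_choice (rdist S w₀ q + rdist S r w) (rdist S q r + rdist S w₀ w) with h' | h' <;>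
          rw [h'] at f <;> linarith
      have t1 := rdist_triangle hS q r w
      have t2 := rdist_triangle hS w₀ q r
      obtain ⟨a, ha, hqa⟩ := exists_coset_point_near hS h4 hδ hQ hε hw₀ hw
        (C := 2 * C₁ + 2 * δ) (p := q) (by linarith)
      obtain ⟨b, hb, hrb⟩ := exists_coset_point_near hS h4 hδ hQ hε hw₀ hw
        (C := 2 * C₁ + 2 * δ) (p := r) (by linarith)
      have hR0 : 0 ≤ R := by linarith
      exact hB₀ c c' hcc q r a q b r ha hb hq hr (by linarith) (by linarith)
        (by rwa [rdist_self]) (by rwa [rdist_self])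
  have p := hrp u hu
  have t1 := rdist_triangle hS w r q
  have t2 := rdist_triangle hS q r u
  have c1 := rdist_comm hS r q
  linarith

end WordMetric

open WordMetric

/-- The amalgam of `G` and `H × ℤ/2` over `H`, described by its inclusion of `G`, the involution
`t` centralising `H`, the retraction onto `G` and, for the action on the Bass–Serre tree, the
function `wall` sending `x` to the coset of `H` labelling the first edge on the way from the
base vertex to its translate by `x`. -/
structure Doubling {G : Type*} [Group G] (H : Subgroup G) (Γ : Type*) [Group Γ] where
  incl : G →* Γ
  t : Γ
  retr : Γ →* G
  wall : Γ → Option (G ⧸ H)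
  retr_incl : ∀ g, retr (incl g) = g
  retr_t : retr t = 1
  t_mul_t : t * t = 1
  t_mul_incl : ∀ h ∈ H, t * incl h = incl h * t
  closure_eq_top : Subgroup.closure (Set.range incl ∪ {t}) = ⊤
  wall_eq_none_iff : ∀ x, wall x = none ↔ ∃ g, incl g = x
  wall_incl_mul : ∀ g x, wall (incl g * x) = (wall x).map (g • ·)
  wall_mul_incl : ∀ x g, wall (x * incl g) = wall x
  wall_t : wall t = some ((1 : G) : G ⧸ H)
  wall_mul_t : ∀ x, wall x ≠ none → wall (x * t) ≠ none → wall (x * t) = wall x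
  wall_t_mul_iff : ∀ x, wall (t * x) = some ((1 : G) : G ⧸ H) ↔ wall x ≠ some ((1 : G) : G ⧸ H)

namespace Doubling

variable {G : Type*} [Group G] {H : Subgroup G} {Γ : Type*} [Group Γ] (D : Doubling H Γ)
  {S : Set G}

/-- The generating set of the doubling obtained from a generating set of `G`. -/
def gens (S : Set G) : Set Γ := D.incl '' S ∪ {D.t}

lemma inv_t : D.t⁻¹ = D.t := inv_eq_of_mul_eq_one_right D.t_mul_t

lemma wall_incl (g : G) : D.wall (D.incl g) = none := (D.wall_eq_none_iff _).2 ⟨g, rfl⟩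

lemma wall_incl_mul_t (g : G) : D.wall (D.incl g * D.t) = some (g : G ⧸ H) := by
  rw [D.wall_incl_mul, D.wall_t, Option.map_some]
  simp

lemma wall_inv_mul_eq_one_iff (k : G) (x : Γ) :
    D.wall (D.incl k⁻¹ * x) = some ((1 : G) : G ⧸ H) ↔ D.wall x = some (k : G ⧸ H) := by
  have key : ∀ (g : G) (y : Γ) (a : G), D.wall y = some (a : G ⧸ H) →
      D.wall (D.incl g * y) = some ((g * a : G) : G ⧸ H) := by
    intro g y a h
    rw [D.wall_incl_mul, h, Option.map_some]
    simp
  constructor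
  · intro h
    have := key k _ _ h
    rwa [← mul_assoc, ← map_mul, mul_inv_cancel, map_one, one_mul, mul_one] at this
  · intro h
    simpa using key k⁻¹ x k h

lemma isSymmGenSet_gens (hS : IsSymmGenSet S) : IsSymmGenSet (D.gens S) := by
  refine ⟨(hS.1.image _).union (Set.finite_singleton _), ?_, ?_⟩
  · rw [gens, Set.union_inv, Set.inv_singleton, D.inv_t, ← Set.image_inv_of_apply_inv_eq_inv, hS.2.1]
    intro x _
    simp
  · rw [eq_top_iff, ← D.closure_eq_top, Subgroup.closure_le]
    rintro x (⟨g, rfl⟩ | rfl)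
    · have hg : g ∈ (Subgroup.closure (D.gens S)).comap D.incl := by
        have : Subgroup.closure S ≤ (Subgroup.closure (D.gens S)).comap D.incl := by
          rw [Subgroup.closure_le]
          exact fun s hs => Subgroup.subset_closure (Or.inl ⟨s, hs, rfl⟩)
        exact this (by rw [hS.2.2]; trivial)
      exact hg
    · exact Subgroup.subset_closure (Or.inr rfl)

lemma rdist_retr_le (hS : IsSymmGenSet S) (x y : Γ) :
    rdist S (D.retr x) (D.retr y) ≤ rdist (D.gens S) x y := by
  have key : ∀ l : List Γ, (∀ z ∈ l, z ∈ D.gens S) → wordLength S (D.retr l.prod) ≤ l.length := by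
    intro l
    induction l with
    | nil => simp [wordLength_one]
    | cons s l ih =>
      intro hl
      have h1 := ih fun z hz => hl z (by simp [hz])
      have h2 : wordLength S (D.retr s) ≤ 1 := by
        rcases hl s (by simp) with ⟨g, hg, rfl⟩ | h
        · rw [D.retr_incl]
          exact wordLength_le_one hg
        · rw [Set.mem_singleton_iff.1 h, D.retr_t, wordLength_one]
          exact Nat.zero_le _
      have h3 := wordLength_mul_le hS (D.retr s) (D.retr l.prod)
      simp only [List.prod_cons, map_mul, List.length_cons]
      omega
  obtain ⟨l, hl, hp, hn⟩ := exists_list (D.isSymmGenSet_gens hS) (x⁻¹ * y)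
  have := key l hl
  rw [hp, hn, map_mul, map_inv] at this
  exact Nat.cast_le.2 this

lemma rdist_incl (hS : IsSymmGenSet S) (g h : G) :
    rdist (D.gens S) (D.incl g) (D.incl h) = rdist S g h := by
  apply le_antisymm
  · obtain ⟨l, hl, hp, hn⟩ := exists_list hS (g⁻¹ * h)
    have : wordLength (D.gens S) (l.map D.incl).prod ≤ (l.map D.incl).length := by
      apply wordLength_le_length
      intro x hx
      obtain ⟨s, hs, rfl⟩ := List.mem_map.1 hx
      exact Or.inl ⟨s, hl s hs, rfl⟩
    rw [← map_list_prod, hp, map_mul, map_inv, List.length_map, hn] at this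
    exact Nat.cast_le.2 this
  · simpa [D.retr_incl] using D.rdist_retr_le hS (D.incl g) (D.incl h)

lemma rdist_mul_t_le (x : Γ) : rdist (D.gens S) x (x * D.t) ≤ 1 := by
  have : wordLength (D.gens S) D.t ≤ 1 := wordLength_le_one (Or.inr rfl)
  simp only [rdist, wordDist, inv_mul_cancel_left]
  exact_mod_cast this

/-- A geodesic leaving the half space behind a wall crosses this wall. -/
lemma exists_wall_crossing (hS : IsSymmGenSet S) {x y : Γ} {c : G ⧸ H} (hx : D.wall x = some c)
    (hy : D.wall y ≠ some c) : ∃ u : G, (u : G ⧸ H) = c ∧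
      rdist (D.gens S) x (D.incl u * D.t) + 1 + rdist (D.gens S) (D.incl u) y ≤
        rdist (D.gens S) x y := by
  obtain ⟨z, s, hs, hz, hzs, hd⟩ :=
    exists_first_crossing (D.isSymmGenSet_gens hS) (fun z => D.wall z = some c) hx hy
  rcases hs with ⟨g, -, rfl⟩ | h
  · rw [D.wall_mul_incl] at hzs
    exact absurd hz hzs
  · rw [Set.mem_singleton_iff.1 h] at hzs hd
    have hnone : D.wall (z * D.t) = none := by
      by_contra hne
      exact hzs ((D.wall_mul_t z (by simp [hz]) hne).trans hz)
    obtain ⟨u, hu⟩ := (D.wall_eq_none_iff _).1 hnone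
    have hz' : z = D.incl u * D.t := by rw [hu, mul_assoc, D.t_mul_t, mul_one]
    refine ⟨u, ?_, by rw [← hz', hu]; exact hd⟩
    rw [hz', D.wall_incl_mul_t] at hz
    exact Option.some_injective _ hz

lemma exists_wall_point (hS : IsSymmGenSet S) {x y : Γ} {c : G ⧸ H} (hx : D.wall x = some c)
    (hy : D.wall y ≠ some c) : ∃ u : G, (u : G ⧸ H) = c ∧
      rdist (D.gens S) x (D.incl u) + rdist (D.gens S) (D.incl u) y ≤ rdist (D.gens S) x y := by
  obtain ⟨u, hu, hd⟩ := D.exists_wall_crossing hS hx hy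
  refine ⟨u, hu, ?_⟩
  have hT := D.isSymmGenSet_gens hS
  have t1 := rdist_triangle hT x (D.incl u * D.t) (D.incl u)
  have t2 := D.rdist_mul_t_le (S := S) (D.incl u)
  have c1 := rdist_comm hT (D.incl u) (D.incl u * D.t)
  linarith

/-- A geodesic does not cross a wall twice. -/
lemma wall_ne_of_geodesic (hS : IsSymmGenSet S) {x y : Γ}
    (h : rdist (D.gens S) x 1 + rdist (D.gens S) 1 y = rdist (D.gens S) x y) {c : G ⧸ H}
    (hx : D.wall x = some c) : D.wall y ≠ some c := by
  intro hy
  have hT := D.isSymmGenSet_gens hS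
  have h1 : D.wall 1 ≠ some c := by
    have := D.wall_incl 1
    rw [map_one] at this
    simp [this]
  obtain ⟨u, hu, hud⟩ := D.exists_wall_crossing hS hx h1
  obtain ⟨v, hv, hvd⟩ := D.exists_wall_crossing hS hy h1
  have huv : u⁻¹ * v ∈ H := QuotientGroup.eq.1 (hu.trans hv.symm)
  have hd : rdist (D.gens S) (D.incl u * D.t) (D.incl v * D.t) =
      rdist (D.gens S) (D.incl u) (D.incl v) := by
    unfold rdist wordDist
    congr 2
    calc (D.incl u * D.t)⁻¹ * (D.incl v * D.t)
        = D.t * D.incl (u⁻¹ * v) * D.t := by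
          rw [mul_inv_rev, D.inv_t, map_mul, map_inv]; group
      _ = (D.incl u)⁻¹ * D.incl v := by
          rw [D.t_mul_incl _ huv, mul_assoc, D.t_mul_t, mul_one, map_mul, map_inv]
  have t1 := rdist_triangle hT x (D.incl u * D.t) y
  have t2 := rdist_triangle hT (D.incl u * D.t) (D.incl v * D.t) y
  have t3 := rdist_triangle hT (D.incl u) 1 (D.incl v)
  have c1 := rdist_comm hT 1 (D.incl v)
  have c2 := rdist_comm hT (D.incl v * D.t) y
  have c3 := rdist_comm hT 1 y
  linarith

/-- `q` is a coarse nearest point projection of `z` to the base copy of `G`. -/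
def IsProj (S : Set G) (C : ℝ) (z : Γ) (q : G) : Prop :=
  ∀ u : G, rdist (D.gens S) z (D.incl q) + rdist S q u ≤ rdist (D.gens S) z (D.incl u) + C

lemma isProj_of_wall (hS : IsSymmGenSet S) {C : ℝ} {z : Γ} {k q : G}
    (hz : D.wall z = some (k : G ⧸ H)) (hq : q ∈ H)
    (h : ∀ u ∈ H, rdist (D.gens S) (D.t * D.incl k⁻¹ * z) (D.incl q) + rdist S q u ≤
      rdist (D.gens S) (D.t * D.incl k⁻¹ * z) (D.incl u * D.t) + C) :
    D.IsProj S (C + 1) z (k * q) := by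
  intro u
  have hT := D.isSymmGenSet_gens hS
  obtain ⟨u', hu', hd⟩ := D.exists_wall_point hS hz (y := D.incl u) (by simp [D.wall_incl])
  have key : ∀ w ∈ H, rdist (D.gens S) z (D.incl (k * w)) =
      rdist (D.gens S) (D.t * D.incl k⁻¹ * z) (D.incl w * D.t) := by
    intro w hw
    rw [← D.t_mul_incl w hw, ← rdist_mul_left (D.t * D.incl k⁻¹)]
    congr 1
    simp [mul_assoc]
  have hw : k⁻¹ * u' ∈ H := QuotientGroup.eq.1 hu'.symm
  have h1 := key _ hw
  rw [mul_inv_cancel_left] at h1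
  have h2 := key q hq
  have h3 := h _ hw
  have t1 := rdist_triangle hT (D.t * D.incl k⁻¹ * z) (D.incl q) (D.incl q * D.t)
  have t2 := D.rdist_mul_t_le (S := S) (D.incl q)
  have t3 := rdist_triangle hS (k * q) u' u
  have h4 : rdist S (k * q) u' = rdist S q (k⁻¹ * u') := by
    rw [← rdist_mul_left k q, mul_inv_cancel_left]
  rw [D.rdist_incl hS] at hd
  linarith

variable {δ ε : ℝ}

lemma rdist_le_rdist_mul_t (hS : IsSymmGenSet S) (p u : G) :
    rdist S p u ≤ rdist (D.gens S) (D.incl p) (D.incl u * D.t) := by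
  simpa [D.retr_incl, D.retr_t] using D.rdist_retr_le hS (D.incl p) (D.incl u * D.t)

lemma exists_isProj (hS : IsSymmGenSet S) (h4 : FourPoint S δ) (hδ : 0 ≤ δ)
    (hQ : IsQuasiconvex S ε (H : Set G)) (hε : 0 ≤ ε) (hM : AlmostMalnormal H) :
    ∃ C : ℝ, 0 ≤ C ∧
      (∀ z : Γ, ∃ q : G, D.IsProj S C z q ∧ ∀ c, D.wall z = some c → (q : G ⧸ H) = c) ∧
      ∀ (k : G) (b : G ⧸ H), b ≠ ((1 : G) : G ⧸ H) → ∃ q : G, (q : G ⧸ H) = k ∧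
        ∀ z, D.wall z = some (k : G ⧸ H) →
          D.wall (D.t * D.incl k⁻¹ * z) = some b → D.IsProj S C z q := by
  have hT := D.isSymmGenSet_gens hS
  obtain ⟨B, hB, hproj⟩ := exists_common_projection hS h4 hδ hQ hε hM
  set C₁ : ℝ := 2 * (ε + 2 * δ + 1) with hC₁
  set C := max B C₁ with hC
  have mono : ∀ {C' : ℝ} {z : Γ} {q : G}, D.IsProj S C' z q → C' ≤ C + 1 →
      D.IsProj S (C + 1) z q := fun h hle u => (h u).trans (by linarith)
  have hC0 : 0 ≤ C := hB.trans (le_max_left _ _)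
  have hmem : ∀ {q : G}, (q : G ⧸ H) = ((1 : G) : G ⧸ H) ↔ q ∈ H := by
    intro q
    rw [eq_comm, QuotientGroup.eq, inv_one, one_mul]
  have hcoset : ∀ {k q : G}, q ∈ H → ((k * q : G) : G ⧸ H) = k := fun hq =>
    (QuotientGroup.eq.2 (by simpa using hq)).symm
  have second : ∀ (k : G) (b : G ⧸ H), b ≠ ((1 : G) : G ⧸ H) → ∃ q : G, (q : G ⧸ H) = k ∧
        ∀ z, D.wall z = some (k : G ⧸ H) →
          D.wall (D.t * D.incl k⁻¹ * z) = some b → D.IsProj S (C + 1) z q := by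
    intro k b hb
    obtain ⟨q, hq, hqp⟩ := hproj b _ hb
    have hqH := hmem.1 hq
    refine ⟨k * q, hcoset hqH, fun z hz hz' => mono (D.isProj_of_wall hS hz hqH (C := B) ?_)
      (by linarith [le_max_left B C₁])⟩
    intro u hu
    obtain ⟨w, hw, hd⟩ := D.exists_wall_point hS hz' (y := D.incl u * D.t) (by
      rw [D.wall_incl_mul_t, hmem.2 hu]
      exact fun h => hb (Option.some_injective _ h).symm)
    have h1 := hqp w u hw (hmem.2 hu)
    have h2 := D.rdist_le_rdist_mul_t hS w u
    have h3 := rdist_triangle hT (D.t * D.incl k⁻¹ * z) (D.incl w) (D.incl q)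
    rw [D.rdist_incl hS] at h3
    linarith
  refine ⟨C + 1, by linarith, fun z => ?_, second⟩
  rcases hz : D.wall z with _ | c
  · obtain ⟨p, rfl⟩ := (D.wall_eq_none_iff z).1 hz
    refine ⟨p, fun u => ?_, by simp⟩
    rw [rdist_self, D.rdist_incl hS]
    linarith
  · obtain ⟨k, rfl⟩ := QuotientGroup.mk_surjective c
    change D.wall z = some (k : G ⧸ H) at hz
    rcases hz' : D.wall (D.t * D.incl k⁻¹ * z) with _ | b
    · obtain ⟨p, hp⟩ := (D.wall_eq_none_iff _).1 hz'
      obtain ⟨q, hq, hqp⟩ := exists_coset_projection hS h4 hδ hQ hε ((1 : G) : G ⧸ H) p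
      have hqH := hmem.1 hq
      refine ⟨k * q, mono (D.isProj_of_wall hS hz hqH (C := C₁) ?_)
        (by linarith [le_max_right B C₁]), ?_⟩
      · intro u hu
        rw [← hp, D.rdist_incl hS]
        have h1 := hqp u (hmem.2 hu)
        have h2 := D.rdist_le_rdist_mul_t hS p u
        linarith
      · rintro c hc
        rw [hcoset hqH]
        exact Option.some_injective _ hc
    · have hb : b ≠ ((1 : G) : G ⧸ H) := by
        rintro rfl
        rw [mul_assoc, D.wall_t_mul_iff, Ne, D.wall_inv_mul_eq_one_iff] at hz'
        exact hz' hz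
      obtain ⟨q, hq, hqp⟩ := second k b hb
      refine ⟨q, hqp z hz hz', fun c hc => ?_⟩
      rw [hq]
      exact Option.some_injective _ hc

lemma gromovProd_proj_le (hS : IsSymmGenSet S) {C : ℝ} {x y : Γ} {p q : G}
    (hp : D.IsProj S C x p) (hq : D.IsProj S C y q) :
    rdist S p 1 + rdist S 1 q - rdist S p q ≤
      rdist (D.gens S) x 1 + rdist (D.gens S) 1 y - rdist (D.gens S) x y + 2 * C := by
  have hT := D.isSymmGenSet_gens hS
  have h1 := hp 1
  have h2 := hq 1
  rw [map_one] at h1 h2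
  have t1 := rdist_triangle hT x (D.incl p) y
  have t2 := rdist_triangle hT (D.incl p) (D.incl q) y
  rw [D.rdist_incl hS] at t2
  have c1 := rdist_comm hT y (D.incl q)
  have c2 := rdist_comm hT y 1
  have c3 := rdist_comm hS q 1
  linarith

lemma gromovProd_le_proj (hS : IsSymmGenSet S) {C : ℝ} {x y : Γ} {p q : G}
    (hp : D.IsProj S C x p) (hq : D.IsProj S C y q)
    (hxy : ∀ c, D.wall x = some c → D.wall y ≠ some c) :
    rdist (D.gens S) x 1 + rdist (D.gens S) 1 y - rdist (D.gens S) x y ≤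
      rdist S p 1 + rdist S 1 q - rdist S p q + 2 * C := by
  have hT := D.isSymmGenSet_gens hS
  obtain ⟨u, hu⟩ : ∃ u : G, rdist (D.gens S) x (D.incl u) + rdist (D.gens S) (D.incl u) y ≤
      rdist (D.gens S) x y := by
    rcases hx : D.wall x with _ | c
    · obtain ⟨u, rfl⟩ := (D.wall_eq_none_iff x).1 hx
      exact ⟨u, by rw [rdist_self]; linarith⟩
    · obtain ⟨u, -, h⟩ := D.exists_wall_point hS hx (hxy c hx)
      exact ⟨u, h⟩
  have h1 := hp u
  have h2 := hq u
  have t1 := rdist_triangle hT x (D.incl p) 1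
  have t2 := rdist_triangle hT 1 (D.incl q) y
  have t3 := rdist_triangle hS p u q
  rw [← map_one D.incl, D.rdist_incl hS, map_one] at t1 t2
  have c1 := rdist_comm hT y (D.incl q)
  have c2 := rdist_comm hT y (D.incl u)
  have c3 := rdist_comm hS q u
  linarith

lemma rdist_le_of_isProj (hS : IsSymmGenSet S) {C : ℝ} {z : Γ} {p q : G}
    (hp : D.IsProj S C z p) (hq : D.IsProj S C z q) : rdist S p q ≤ C := by
  have h1 := hp q
  have h2 := hq p
  have c1 := rdist_comm hS p q
  linarith

lemma FourPoint.gromovProd_le (hS : IsSymmGenSet S) (h4 : FourPoint S δ) {C : ℝ} {p q r : G}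
    (h : rdist S p 1 + rdist S 1 q - rdist S p q ≤ C) :
    rdist S p 1 + rdist S 1 r - rdist S p r ≤ C + 2 * δ ∨
      rdist S q 1 + rdist S 1 r - rdist S q r ≤ C + 2 * δ := by
  have f := h4 p r q 1
  have c1 := rdist_comm hS r q
  have c2 := rdist_comm hS q 1
  have c3 := rdist_comm hS r 1
  rcases max_choice (rdist S p r + rdist S q 1) (rdist S r q + rdist S p 1) with h' | h' <;>
    rw [h'] at f
  · left; linarith
  · right; linarith

lemma abs_rdist_sub_le {T : Set Γ} (hT : IsSymmGenSet T) (x m m' : Γ) :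
    |rdist T x m - rdist T x m'| ≤ rdist T m m' := by
  have t1 := rdist_triangle hT x m m'
  have t2 := rdist_triangle hT x m' m
  have c1 := rdist_comm hT m m'
  rw [abs_le]
  constructor <;> linarith

theorem exists_gromovProd_bound (hS : IsSymmGenSet S) (h4 : FourPoint S δ) (hδ : 0 ≤ δ)
    (hQ : IsQuasiconvex S ε (H : Set G)) (hε : 0 ≤ ε) (hM : AlmostMalnormal H) :
    ∃ C : ℝ, 0 ≤ C ∧ ∀ x y z : Γ,
      rdist (D.gens S) x 1 + rdist (D.gens S) 1 y = rdist (D.gens S) x y →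
      rdist (D.gens S) x 1 + rdist (D.gens S) 1 z - rdist (D.gens S) x z ≤ C ∨
        rdist (D.gens S) y 1 + rdist (D.gens S) 1 z - rdist (D.gens S) y z ≤ C := by
  have hT := D.isSymmGenSet_gens hS
  obtain ⟨C, hC, hproj, hcommon⟩ := D.exists_isProj hS h4 hδ hQ hε hM
  choose π hπ hπw using hproj
  set K : ℝ := 2 * C + 4 * δ + ε with hK
  set E : ℝ := 8 * C + 2 * δ + 4 * (K + 1) with hE
  refine ⟨E, by linarith, ?_⟩
  set d := rdist (D.gens S) with hd
  -- the case where the projections of `x` and `z` have small Gromov product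
  have key : ∀ x y z : Γ, d x 1 + d 1 y = d x y →
      rdist S (π x) 1 + rdist S 1 (π z) - rdist S (π x) (π z) ≤ 2 * C + 2 * δ →
      d x 1 + d 1 z - d x z ≤ E ∨ d y 1 + d 1 z - d y z ≤ E := by
    intro x y z hxy hxz
    by_cases hshare : ∃ c, D.wall x = some c ∧ D.wall z = some c
    swap
    · left
      have := D.gromovProd_le_proj hS (hπ x) (hπ z) fun c hx hz => hshare ⟨c, hx, hz⟩
      linarith
    obtain ⟨c, hxc, hzc⟩ := hshare
    have hyc : D.wall y ≠ some c := D.wall_ne_of_geodesic hS hxy hxc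
    obtain ⟨k, hkc, hk⟩ := exists_coset_point_near hS h4 hδ hQ hε (hπw x c hxc) (hπw z c hzc)
      (C := 2 * C + 2 * δ) (p := 1) (by linarith)
    subst hkc
    -- move the base point across the wall
    have hm : d 1 (D.incl k * D.t) ≤ K + 1 := by
      have t1 := rdist_triangle hT 1 (D.incl k) (D.incl k * D.t)
      have t2 := D.rdist_mul_t_le (S := S) (D.incl k)
      have t3 := D.rdist_incl hS 1 k
      rw [map_one] at t3
      linarith
    set φ : Γ → Γ := fun w => D.t * D.incl k⁻¹ * w with hφ
    have hφd : ∀ v w, d (φ v) (φ w) = d v w := fun v w => rdist_mul_left _ v w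
    have hφ1 : φ (D.incl k * D.t) = 1 := by
      simp only [hφ]
      rw [mul_assoc, ← mul_assoc (D.incl k⁻¹), ← map_mul, inv_mul_cancel, map_one, one_mul,
        D.t_mul_t]
    have hφm : ∀ v, |d (φ v) 1 - d v 1| ≤ K + 1 := by
      intro v
      have h := hφd v (D.incl k * D.t)
      rw [hφ1] at h
      rw [h, abs_sub_comm]
      exact (abs_rdist_sub_le hT v 1 (D.incl k * D.t)).trans hm
    have hφwall : ∀ v, D.wall (φ v) = some ((1 : G) : G ⧸ H) ↔ D.wall v ≠ some (k : G ⧸ H) := by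
      intro v
      simp only [hφ]
      rw [mul_assoc, D.wall_t_mul_iff, Ne, D.wall_inv_mul_eq_one_iff]
    have hx' : D.wall (φ x) ≠ some ((1 : G) : G ⧸ H) := fun h => (hφwall x).1 h hxc
    have hz' : D.wall (φ z) ≠ some ((1 : G) : G ⧸ H) := fun h => (hφwall z).1 h hzc
    have hy' : D.wall (φ y) = some ((1 : G) : G ⧸ H) := (hφwall y).2 hyc
    have comm1 : ∀ v, d 1 v = d v 1 := fun v => rdist_comm hT 1 v
    have hgp : ∀ v w, d v 1 + d 1 w - d v w ≤
          d (φ v) 1 + d 1 (φ w) - d (φ v) (φ w) + 2 * (K + 1) ∧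
        d (φ v) 1 + d 1 (φ w) - d (φ v) (φ w) ≤ d v 1 + d 1 w - d v w + 2 * (K + 1) := by
      intro v w
      have h1 := abs_le.1 (hφm v)
      have h2 := abs_le.1 (hφm w)
      rw [hφd, comm1 w, comm1 (φ w)]
      constructor <;> linarith
    have g1 := D.gromovProd_proj_le hS (hπ (φ x)) (hπ (φ y))
    have g2 := (hgp x y).2
    rcases FourPoint.gromovProd_le hS h4 (p := π (φ x)) (q := π (φ y)) (r := π (φ z))
      (C := 2 * (K + 1) + 2 * C) (by linarith) with h | h
    · by_cases hshare' : ∃ b, D.wall (φ x) = some b ∧ D.wall (φ z) = some b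
      · obtain ⟨b, hxb, hzb⟩ := hshare'
        obtain ⟨q, -, hq⟩ := hcommon k b (by rintro rfl; exact hx' hxb)
        have e1 := D.rdist_le_of_isProj hS (hq x hxc hxb) (hπ x)
        have e2 := D.rdist_le_of_isProj hS (hq z hzc hzb) (hπ z)
        have t1 := rdist_triangle hS (π x) q (π z)
        have c1 := rdist_comm hS (π x) q
        have t2 := rdist_triangle hS (π y) (π z) (π x)
        have c2 := rdist_comm hS (π x) (π z)
        have t3 := rdist_triangle hS 1 (π x) (π z)
        have c3 := rdist_comm hS (π x) (π y)
        have c4 := rdist_comm hS (π x) 1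
        have c5 := rdist_comm hS (π y) 1
        have f1 := D.gromovProd_proj_le hS (hπ x) (hπ y)
        have f2 := D.gromovProd_le_proj hS (hπ y) (hπ z) fun c hy hz => by
          rw [hzc] at hz
          exact hyc (hy.trans hz.symm)
        right
        linarith
      · have f := D.gromovProd_le_proj hS (hπ (φ x)) (hπ (φ z)) fun b hx hz => hshare' ⟨b, hx, hz⟩
        have g3 := (hgp x z).1
        left
        linarith
    · have f := D.gromovProd_le_proj hS (hπ (φ y)) (hπ (φ z)) fun b hy hz => by
        rw [hy'] at hy
        exact hz' (hz.trans hy.symm)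
      have g3 := (hgp y z).1
      right
      linarith
  intro x y z hxy
  have g1 := D.gromovProd_proj_le hS (hπ x) (hπ y)
  rcases FourPoint.gromovProd_le hS h4 (p := π x) (q := π y) (r := π z) (C := 2 * C) (by linarith)
    with h | h
  · exact key x y z hxy h
  · refine (key y x z ?_ h).symm
    rw [hd, rdist_comm hT y x, rdist_comm hT y 1, rdist_comm hT 1 x]
    linarith

theorem exists_thinTriangles (hS : IsSymmGenSet S) (h4 : FourPoint S δ) (hδ : 0 ≤ δ)
    (hQ : IsQuasiconvex S ε (H : Set G)) (hε : 0 ≤ ε) (hM : AlmostMalnormal H) :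
    ∃ δ' : ℝ, 0 ≤ δ' ∧ ThinTriangles (D.gens S) δ' := by
  obtain ⟨C, hC, h⟩ := D.exists_gromovProd_bound hS h4 hδ hQ hε hM
  refine ⟨2 * C, by linarith,
    thinTriangles_of_gromovProd_le (D.isSymmGenSet_gens hS) fun x y z m hm => ?_⟩
  have := h (m⁻¹ * x) (m⁻¹ * y) (m⁻¹ * z)
  rw [← inv_mul_cancel m] at this
  simp only [rdist_mul_left] at this
  exact this hm

end Doubling

namespace Doubling

variable {G : Type*} [Group G] (H : Subgroup G)

open Classical in
/-- A left transversal of `H` containing `1`. -/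
noncomputable def rep (c : G ⧸ H) : G := if c = ((1 : G) : G ⧸ H) then 1 else c.out

lemma mk_rep (c : G ⧸ H) : ((rep H c : G) : G ⧸ H) = c := by
  unfold rep
  split_ifs with h
  · exact h.symm
  · exact QuotientGroup.out_eq' c

lemma rep_one : rep H ((1 : G) : G ⧸ H) = 1 := by simp [rep]

/-- The element of `H` by which `g` maps the chosen representative of `c` off the one
of `g • c`. -/
noncomputable def cocycle (g : G) (c : G ⧸ H) : G := (rep H (g • c))⁻¹ * g * rep H c

lemma cocycle_mem (g : G) (c : G ⧸ H) : cocycle H g c ∈ H := by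
  unfold cocycle
  rw [mul_assoc, ← QuotientGroup.eq, mk_rep]
  conv_lhs => rw [← mk_rep H c]
  rfl

lemma cocycle_one (c : G ⧸ H) : cocycle H 1 c = 1 := by simp [cocycle]

lemma cocycle_mul (g g' : G) (c : G ⧸ H) :
    cocycle H (g * g') c = cocycle H g (g' • c) * cocycle H g' c := by
  simp only [cocycle, mul_smul]
  group

variable {H}

lemma smul_one_coset {h : G} (hh : h ∈ H) :
    h • ((1 : G) : G ⧸ H) = ((1 : G) : G ⧸ H) := by
  change ((h * 1 : G) : G ⧸ H) = _
  exact QuotientGroup.eq.2 (by simpa using hh)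

lemma smul_coset_ne_one {h : G} (hh : h ∈ H) {c : G ⧸ H} (hc : c ≠ ((1 : G) : G ⧸ H)) :
    h • c ≠ ((1 : G) : G ⧸ H) := by
  intro h'
  apply hc
  rw [← inv_smul_smul h c, h', smul_one_coset (H.inv_mem hh)]

lemma cocycle_one_coset {h : G} (hh : h ∈ H) : cocycle H h ((1 : G) : G ⧸ H) = h := by
  simp [cocycle, smul_one_coset hh, rep_one]

/-- The action of `G` on sequences of cosets of `H`, which label paths in the Bass–Serre tree
starting at the base vertex. -/
noncomputable def act : G → List (G ⧸ H) → List (G ⧸ H)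
  | _, [] => []
  | g, c :: l => (g • c) :: act (cocycle H g c) l

lemma act_one (l : List (G ⧸ H)) : act 1 l = l := by
  induction l with
  | nil => rfl
  | cons c l ih => rw [act, cocycle_one, ih, one_smul]

lemma act_mul (g g' : G) (l : List (G ⧸ H)) : act (g * g') l = act g (act g' l) := by
  induction l generalizing g g' with
  | nil => rfl
  | cons c l ih => rw [act, act, act, cocycle_mul, ih, mul_smul]

lemma act_append (g : G) (l : List (G ⧸ H)) (c : G ⧸ H) :
    ∃ c', act g (l ++ [c]) = act g l ++ [c'] := by
  induction l generalizing g with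
  | nil => exact ⟨g • c, rfl⟩
  | cons b l ih =>
    obtain ⟨c', h⟩ := ih (cocycle H g b)
    exact ⟨c', by simp [act, h]⟩

lemma head?_act (g : G) (l : List (G ⧸ H)) : (act g l).head? = l.head?.map (g • ·) := by
  cases l <;> rfl

lemma ne_one_of_mem_act {h : G} (hh : h ∈ H) {l : List (G ⧸ H)}
    (hl : ∀ c ∈ l, c ≠ ((1 : G) : G ⧸ H)) : ∀ c ∈ act h l, c ≠ ((1 : G) : G ⧸ H) := by
  induction l generalizing h with
  | nil => simp [act]
  | cons b l ih =>
    intro c hc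
    rcases List.mem_cons.1 hc with rfl | hc
    · exact smul_coset_ne_one hh (hl b (by simp))
    · exact ih (cocycle_mem H h b) (fun c hc => hl c (by simp [hc])) c hc

open Classical in
/-- The action of the involution `t` on sequences of cosets. -/
noncomputable def flip : List (G ⧸ H) → List (G ⧸ H)
  | [] => [((1 : G) : G ⧸ H)]
  | c :: l => if c = ((1 : G) : G ⧸ H) then l else ((1 : G) : G ⧸ H) :: c :: l

lemma flip_act {h : G} (hh : h ∈ H) (l : List (G ⧸ H)) : flip (act h l) = act h (flip l) := by
  cases l with
  | nil => simp [flip, act, smul_one_coset hh]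
  | cons c l =>
    by_cases hc : c = ((1 : G) : G ⧸ H)
    · subst hc
      simp [flip, act, smul_one_coset hh, cocycle_one_coset hh]
    · have := smul_coset_ne_one hh hc
      simp [flip, act, smul_one_coset hh, cocycle_one_coset hh, hc, this]

variable (H) in
/-- Vertices of the Bass–Serre tree in the orbit of the base vertex, as sequences of cosets
labelling paths without backtracking. -/
def Vertex : Type _ := {l : List (G ⧸ H) // ∀ c ∈ l.tail, c ≠ ((1 : G) : G ⧸ H)}

noncomputable instance : MulAction G (Vertex H) where
  smul g l := ⟨act g l.1, by
    obtain ⟨l, hl⟩ := l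
    cases l with
    | nil => simp [act]
    | cons c l => exact ne_one_of_mem_act (cocycle_mem H g c) hl⟩
  one_smul l := Subtype.ext (act_one l.1)
  mul_smul g g' l := Subtype.ext (act_mul g g' l.1)

/-- The action of the involution `t` on vertices. -/
noncomputable def vertexFlip (l : Vertex H) : Vertex H := ⟨flip l.1, by
  obtain ⟨l, hl⟩ := l
  cases l with
  | nil => simp [flip]
  | cons c l =>
    by_cases hc : c = ((1 : G) : G ⧸ H)
    · simp only [flip, hc, if_true]
      exact fun b hb => hl b (List.mem_of_mem_tail hb)
    · simp only [flip, hc, if_false, List.tail_cons]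
      intro b hb
      rcases List.mem_cons.1 hb with rfl | hb
      exacts [hc, hl b hb]⟩

lemma vertexFlip_involutive : Function.Involutive (vertexFlip (H := H)) := by
  rintro ⟨l, hl⟩
  apply Subtype.ext
  match l, hl with
  | [], _ => simp [vertexFlip, flip]
  | [c], _ => by_cases hc : c = ((1 : G) : G ⧸ H) <;> simp [vertexFlip, flip, hc]
  | c :: b :: l, hl =>
    have hb : b ≠ ((1 : G) : G ⧸ H) := hl b (by simp)
    by_cases hc : c = ((1 : G) : G ⧸ H) <;> simp [vertexFlip, flip, hc, hb]

lemma head?_vertexFlip_iff (l : Vertex H) :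
    (vertexFlip l).1.head? = some ((1 : G) : G ⧸ H) ↔ l.1.head? ≠ some ((1 : G) : G ⧸ H) := by
  obtain ⟨l, hl⟩ := l
  match l, hl with
  | [], _ => simp [vertexFlip, flip]
  | [c], _ => by_cases hc : c = ((1 : G) : G ⧸ H) <;> simp [vertexFlip, flip, hc]
  | c :: b :: l, hl =>
    have hb : b ≠ ((1 : G) : G ⧸ H) := hl b (by simp)
    by_cases hc : c = ((1 : G) : G ⧸ H) <;> simp [vertexFlip, flip, hc, hb]

/-- Adjacency of paths starting at the base vertex: one extends the other by one edge. -/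
def Extends (l l' : List (G ⧸ H)) : Prop := ∃ c, l' = l ++ [c] ∨ l = l' ++ [c]

lemma Extends.act {l l' : List (G ⧸ H)} (h : Extends l l') (g : G) :
    Extends (act g l) (Doubling.act g l') := by
  obtain ⟨c, rfl | rfl⟩ := h
  · obtain ⟨c', h⟩ := act_append g l c
    exact ⟨c', Or.inl h⟩
  · obtain ⟨c', h⟩ := act_append g l' c
    exact ⟨c', Or.inr h⟩

lemma extends_flip_append (l : List (G ⧸ H)) (c : G ⧸ H) :
    ∃ c', flip (l ++ [c]) = flip l ++ [c'] ∨ flip l = flip (l ++ [c]) ++ [c'] := by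
  cases l with
  | nil => by_cases hc : c = ((1 : G) : G ⧸ H) <;> simp [flip, hc]
  | cons b l => by_cases hb : b = ((1 : G) : G ⧸ H) <;> simp [flip, hb]

lemma Extends.flip {l l' : List (G ⧸ H)} (h : Extends l l') :
    Extends (flip l) (Doubling.flip l') := by
  obtain ⟨c, rfl | rfl⟩ := h
  · exact extends_flip_append l c
  · obtain ⟨c', h⟩ := extends_flip_append l' c
    exact ⟨c', h.symm⟩

lemma Extends.head?_eq {l l' : List (G ⧸ H)} (h : Extends l l') (hl : l.head? ≠ none)
    (hl' : l'.head? ≠ none) : l'.head? = l.head? := by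
  obtain ⟨c, rfl | rfl⟩ := h
  · cases l with
    | nil => simp at hl
    | cons => rfl
  · cases l' with
    | nil => simp at hl'
    | cons => rfl

variable (H) in
/-- The element of `Perm (Vertex H) × G` induced by `g`. -/
noncomputable def modelIncl : G →* Equiv.Perm (Vertex H) × G :=
  (MulAction.toPermHom G (Vertex H)).prod (MonoidHom.id G)

variable (H) in
/-- The element of `Perm (Vertex H) × G` induced by the involution `t`. -/
noncomputable def modelT : Equiv.Perm (Vertex H) × G :=
  (vertexFlip_involutive.toPerm _, 1)

variable (H) in
/-- The amalgam of `G` and `H × ℤ/2` over `H`, as a group acting on the Bass–Serre tree and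
on `G`. -/
def Model : Subgroup (Equiv.Perm (Vertex H) × G) :=
  Subgroup.closure (Set.range (modelIncl H) ∪ {modelT H})

namespace Model

variable (H) in
/-- The inclusion of `G` into the model. -/
noncomputable def incl : G →* Model H :=
  (modelIncl H).codRestrict _ fun g => Subgroup.subset_closure (Or.inl ⟨g, rfl⟩)

variable (H) in
/-- The involution of the model. -/
noncomputable def t : Model H := ⟨modelT H, Subgroup.subset_closure (Or.inr rfl)⟩

/-- The translate of the base vertex by `x`. -/
def vertex (x : Model H) : Vertex H := x.1.1 ⟨[], by simp⟩

lemma vertex_incl_mul (g : G) (x : Model H) : vertex (incl H g * x) = g • vertex x := rfl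

lemma vertex_t_mul (x : Model H) : vertex (t H * x) = vertexFlip (vertex x) := rfl

lemma t_mul_t : t H * t H = 1 := by
  refine Subtype.ext (Prod.ext (Equiv.ext fun l => ?_) (one_mul 1))
  exact vertexFlip_involutive l

lemma t_mul_incl {h : G} (hh : h ∈ H) : t H * incl H h = incl H h * t H := by
  refine Subtype.ext (Prod.ext (Equiv.ext fun l => ?_) ?_)
  · exact Subtype.ext (flip_act hh l.1)
  · exact (one_mul h).trans (mul_one h).symm

lemma closure_eq_top : Subgroup.closure (Set.range (incl H) ∪ {t H}) = ⊤ := by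
  refine Eq.trans ?_ (Subgroup.closure_closure_coe_preimage
    (k := Set.range (modelIncl H) ∪ {modelT H}))
  congr 1
  ext x
  simp only [Set.mem_union, Set.mem_range, Set.mem_singleton_iff]
  exact or_congr (exists_congr fun g => Subtype.ext_iff) Subtype.ext_iff

lemma induction {P : Model H → Prop} (one : P 1) (incl_mul : ∀ g x, P x → P (incl H g * x))
    (t_mul : ∀ x, P x → P (t H * x)) (x : Model H) : P x := by
  have hx : x ∈ Subgroup.closure (Set.range (incl H) ∪ {t H}) := by
    rw [closure_eq_top]; trivial
  have ht : (t H)⁻¹ = t H := inv_eq_of_mul_eq_one_right t_mul_t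
  induction hx using Subgroup.closure_induction_left with
  | one => exact one
  | mul_left y hy z _ ih =>
    rcases hy with ⟨g, rfl⟩ | hy
    · exact incl_mul g z ih
    · rw [Set.mem_singleton_iff.1 hy]
      exact t_mul z ih
  | inv_mul_cancel y hy z _ ih =>
    rcases hy with ⟨g, rfl⟩ | hy
    · rw [← map_inv]
      exact incl_mul _ z ih
    · rw [Set.mem_singleton_iff.1 hy, ht]
      exact t_mul z ih

/-- A chosen element of the model moving the base vertex to the given vertex. -/
noncomputable def lift : List (G ⧸ H) → Model H
  | [] => 1
  | c :: l => incl H (rep H c) * t H * lift l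

lemma incl_mul_lift (g : G) (l : List (G ⧸ H)) :
    ∃ g', incl H g * lift l = lift (act g l) * incl H g' := by
  induction l generalizing g with
  | nil => exact ⟨g, by simp [lift, act]⟩
  | cons c l ih =>
    obtain ⟨g', h⟩ := ih (cocycle H g c)
    refine ⟨g', ?_⟩
    have h1 : g * rep H c = rep H (g • c) * cocycle H g c := by simp [cocycle, mul_assoc]
    calc incl H g * (incl H (rep H c) * t H * lift l)
        = incl H (rep H (g • c)) * (incl H (cocycle H g c) * t H) * lift l := by
          rw [← mul_assoc, ← mul_assoc, ← mul_assoc, ← map_mul, ← map_mul, h1]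
      _ = incl H (rep H (g • c)) * t H * (incl H (cocycle H g c) * lift l) := by
          rw [← t_mul_incl (cocycle_mem H g c)]; simp only [mul_assoc]
      _ = lift (act g (c :: l)) * incl H g' := by rw [h, act, lift, ← mul_assoc]

lemma t_mul_lift (l : List (G ⧸ H)) : t H * lift l = lift (flip l) := by
  cases l with
  | nil => simp [lift, flip, rep_one]
  | cons c l =>
    by_cases hc : c = ((1 : G) : G ⧸ H)
    · subst hc
      simp only [lift, flip, if_true, rep_one, map_one, one_mul]
      rw [← mul_assoc, t_mul_t, one_mul]
    · simp [lift, flip, hc, rep_one]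

lemma exists_eq_lift_mul (x : Model H) : ∃ g, x = lift (vertex x).1 * incl H g := by
  induction x using induction with
  | one => exact ⟨1, by rw [map_one, mul_one]; rfl⟩
  | incl_mul g x ih =>
    obtain ⟨g₁, h₁⟩ := ih
    obtain ⟨g₂, h₂⟩ := incl_mul_lift g (vertex x).1
    refine ⟨g₂ * g₁, ?_⟩
    rw [vertex_incl_mul]
    calc incl H g * x = incl H g * lift (vertex x).1 * incl H g₁ := by rw [mul_assoc, ← h₁]
      _ = _ := by rw [h₂, map_mul, mul_assoc]; rfl
  | t_mul x ih =>
    obtain ⟨g, h⟩ := ih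
    refine ⟨g, ?_⟩
    rw [vertex_t_mul]
    calc t H * x = t H * lift (vertex x).1 * incl H g := by rw [mul_assoc, ← h]
      _ = _ := by rw [t_mul_lift]; rfl

lemma extends_vertex_mul_t (x : Model H) : Extends (vertex x).1 (vertex (x * t H)).1 := by
  induction x using induction with
  | one => exact ⟨((1 : G) : G ⧸ H), Or.inl rfl⟩
  | incl_mul g x ih => exact ih.act g
  | t_mul x ih => exact ih.flip

variable (H) in
/-- The model is a doubling of `G` along `H`. -/
noncomputable def doubling : Doubling H (Model H) where
  incl := incl H
  t := t H
  retr := (MonoidHom.snd _ _).comp (Model H).subtype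
  wall x := (vertex x).1.head?
  retr_incl _ := rfl
  retr_t := rfl
  t_mul_t := t_mul_t
  t_mul_incl _ hh := t_mul_incl hh
  closure_eq_top := closure_eq_top
  wall_eq_none_iff x := by
    rw [List.head?_eq_none_iff]
    constructor
    · intro h
      obtain ⟨g, hg⟩ := exists_eq_lift_mul x
      rw [h, lift, one_mul] at hg
      exact ⟨g, hg.symm⟩
    · rintro ⟨g, rfl⟩
      rfl
  wall_incl_mul g x := head?_act g _
  wall_mul_incl _ _ := rfl
  wall_t := rfl
  wall_mul_t x h h' := (extends_vertex_mul_t x).head?_eq h h'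
  wall_t_mul_iff x := head?_vertexFlip_iff (vertex x)

end Model

end Doubling

lemma not_separable_bot_of_not_residuallyFinite {G : Type*} [Group G]
    (h : ¬ ResiduallyFinite G) : ¬ SeparableSubset G ((⊥ : Subgroup G) : Set G) := by
  intro hsep
  apply h
  rw [ResiduallyFinite, eq_bot_iff]
  intro x hx
  have hxN : ∀ N : Subgroup G, N.Normal → N.FiniteIndex → x ∈ N := by
    intro N h1 h2
    simp only [Subgroup.mem_iInf] at hx
    exact hx N ⟨h1, h2⟩
  by_contra hx1
  have hopen := @IsClosed.isOpen_compl G (profiniteTopology G) _ hsep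
  have key : ∀ U : Set G, TopologicalSpace.GenerateOpen
      {U : Set G | ∃ (g : G) (N : Subgroup G), N.Normal ∧ N.FiniteIndex ∧ U = g • (N : Set G)} U →
      x ∈ U → (1 : G) ∈ U := by
    intro U hU
    induction hU with
    | basic U hU =>
      obtain ⟨g, N, h1, h2, rfl⟩ := hU
      intro hxU
      rw [mem_leftCoset_iff] at hxU ⊢
      simpa using N.mul_mem hxU (N.inv_mem (hxN N h1 h2))
    | univ => exact fun _ => trivial
    | inter U V _ _ ihU ihV => exact fun hUV => ⟨ihU hUV.1, ihV hUV.2⟩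
    | sUnion 𝒰 _ ih =>
      rintro ⟨U, hU, hxU⟩
      exact ⟨U, hU, ih U hU hxU⟩
  exact key _ hopen hx1 (Subgroup.one_mem _)

namespace Doubling

variable {G : Type*} [Group G] {H : Subgroup G} {Γ : Type*} [Group Γ]

theorem separable_of_residuallyFinite (D : Doubling H Γ) (hΓ : ResiduallyFinite Γ) :
    SeparableSubset G (H : Set G) := by
  let _ := profiniteTopology G
  change IsClosed (H : Set G)
  rw [← isOpen_compl_iff, isOpen_iff_forall_mem_open]
  intro g hg
  have hne : D.t * D.incl g * D.t * (D.incl g)⁻¹ ≠ 1 := by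
    intro h
    have h1 : D.wall (D.t * (D.incl g * D.t)) = some ((1 : G) : G ⧸ H) := by
      rw [D.wall_t_mul_iff, D.wall_incl_mul_t]
      intro h
      exact hg (by simpa using QuotientGroup.eq.1 (Option.some_injective _ h).symm)
    rw [← mul_assoc, mul_inv_eq_one.1 h, D.wall_incl] at h1
    cases h1
  obtain ⟨N, hN, hNf, hgN⟩ : ∃ N : Subgroup Γ, N.Normal ∧ N.FiniteIndex ∧
      D.t * D.incl g * D.t * (D.incl g)⁻¹ ∉ N := by
    by_contra! hcon
    apply hne
    rw [← Subgroup.mem_bot, ← hΓ]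
    simp only [Subgroup.mem_iInf]
    exact fun N hN => hcon N hN.1 hN.2
  refine ⟨g • ((N.comap D.incl : Subgroup G) : Set G), ?_, ?_, ?_⟩
  · intro x hx hxH
    rw [mem_leftCoset_iff] at hx
    apply hgN
    have hn : D.incl (g⁻¹ * x) ∈ N := hx
    have hcomm := D.t_mul_incl x hxH
    have hg : D.incl g = D.incl x * (D.incl (g⁻¹ * x))⁻¹ := by simp
    have hconj := hN.conj_mem _
      (N.mul_mem (hN.conj_mem _ (N.inv_mem hn) D.t) hn) (D.incl x)
    generalize D.incl (g⁻¹ * x) = n at *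
    rw [hg]
    convert hconj using 1
    rw [D.inv_t, mul_inv_rev, inv_inv]
    simp only [← mul_assoc]
    rw [hcomm]
  · exact TopologicalSpace.GenerateOpen.basic _
      ⟨g, N.comap D.incl, hN.comap _,
        ⟨(N.index_comap D.incl).trans_ne Subgroup.FiniteIndex.index_ne_zero⟩, rfl⟩
  · rw [mem_leftCoset_iff]
    simp

end Doubling

/-- **Proposition.** There exists a non-residually finite word hyperbolic group if and
only if there is a word hyperbolic group `G` having an almost malnormal quasiconvex
subgroup `H` which is not separable in `G`. -/
theorem nonRF_hyperbolic_iff_nonseparable_almost_malnormal_quasiconvex :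
    (∃ (G : Type) (_ : Group G) (S : Set G), IsSymmGenSet S ∧
        (∃ δ : ℝ, 0 ≤ δ ∧ ThinTriangles S δ) ∧ ¬ ResiduallyFinite G) ↔
    (∃ (G : Type) (_ : Group G) (S : Set G), IsSymmGenSet S ∧
        (∃ δ : ℝ, 0 ≤ δ ∧ ThinTriangles S δ) ∧
        ∃ H : Subgroup G, AlmostMalnormal H ∧
          (∃ ε : ℝ, 0 ≤ ε ∧ IsQuasiconvex S ε (H : Set G)) ∧
          ¬ SeparableSubset G (H : Set G)) := by
  constructor
  · rintro ⟨G, _, S, hS, hδ, hRF⟩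
    refine ⟨G, _, S, hS, hδ, ⊥, ?_, ⟨0, le_rfl, ?_⟩,
      not_separable_bot_of_not_residuallyFinite hRF⟩
    · exact fun x _ => (Set.finite_singleton (1 : G)).subset fun y hy => hy.1
    · intro u hu v hv p hp i hi
      obtain rfl : u = 1 := hu
      obtain rfl : v = 1 := hv
      have h0 : wordDist S (1 : G) 1 = 0 := by simp [wordDist, wordLength_one]
      rw [h0, Nat.le_zero] at hi
      subst hi
      exact ⟨1, rfl, by rw [hp.1, h0]; simp⟩
  · rintro ⟨G, _, S, hS, ⟨δ, hδ, hthin⟩, H, hM, ⟨ε, hε, hQ⟩, hsep⟩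
    let D := Doubling.Model.doubling H
    exact ⟨Doubling.Model H, inferInstance, D.gens S, D.isSymmGenSet_gens hS,
      D.exists_thinTriangles hS (fourPoint_of_thinTriangles hS hthin) (by linarith) hQ hε hM,
      fun hRF => hsep (D.separable_of_residuallyFinite hRF)⟩
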